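/- There is a constant c > 0 such that for every g : ℤ × ℝ → ℂ with ‖g‖_{0,3/8} = (Σ_{ξ∈ℤ} ∫_ℝ ⟨λ − ξ²⟩^{3/4} |g(ξ,λ)|² dλ)^{1/2} < ∞, the function f(x, t) = Σ_{ξ∈ℤ} e^{2πiξx} ∫_ℝ g(ξ, λ) e^{2πiλt} dλ satisfies ‖f‖_{L⁴(T × [0,1])} ≤ c ‖g‖_{0,3/8}. -/

import Mathlib

open MeasureTheory Complex Real ENNReal

/-- The Bourgain `X^{0,3/8}` norm (1-dimensional periodic Schrödinger equation) on the
Fourier side: `‖g‖_{0,3/8} = (∑_{ξ∈ℤ} ∫ ⟨λ−ξ²⟩^{3/4} |g(ξ,λ)|² dλ)^{1/2}`. -/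
noncomputable def XNorm038 (g : ℤ → ℝ → ℂ) : ℝ≥0∞ :=
  (∑' ξ : ℤ, ∫⁻ lam : ℝ,
    ENNReal.ofReal (Real.sqrt (1 + (lam - (ξ : ℝ) ^ 2) ^ 2) ^ ((3:ℝ)/4) * ‖g ξ lam‖ ^ 2))
      ^ ((1:ℝ)/2)

/-- The spacetime function with Fourier transform `g`:
`f(x,t) = ∑_ξ e^{2πiξx} ∫ g(ξ,λ) e^{2πiλt} dλ`. -/
noncomputable def spacetimeFn (g : ℤ → ℝ → ℂ) (x t : ℝ) : ℂ :=
  ∑' ξ : ℤ, Complex.exp (2 * Real.pi * Complex.I * (ξ : ℂ) * (x : ℂ)) *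
    ∫ lam : ℝ, g ξ lam * Complex.exp (2 * Real.pi * Complex.I * (lam : ℂ) * (t : ℂ))



namespace Stri
/-- unit interval measure -/
noncomputable def mu1 : Measure ℝ := volume.restrict (Set.Icc (0:ℝ) 1)
noncomputable def mu2 : Measure (ℝ × ℝ) := mu1.prod mu1
noncomputable def e (y : ℝ) : ℂ := Complex.exp (2 * Real.pi * Complex.I * (y : ℂ))

instance : IsProbabilityMeasure mu1 := ⟨by simp [mu1]⟩
instance : IsProbabilityMeasure mu2 := by unfold mu2; infer_instance

lemma e_add (a b : ℝ) : e (a + b) = e a * e b := by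
  simp only [e, ← Complex.exp_add]; congr 1; push_cast; ring
lemma norm_e (a : ℝ) : ‖e a‖ = 1 := by
  have : e a = Complex.exp (((2 * Real.pi * a : ℝ) : ℂ) * Complex.I) := by
    simp only [e]; congr 1; push_cast; ring
  rw [this, Complex.norm_exp_ofReal_mul_I]
lemma conj_e (a : ℝ) : (starRingEnd ℂ) (e a) = e (-a) := by
  simp only [e, ← Complex.exp_conj]; congr 1; simp [map_ofNat]
lemma cont_e : Continuous e := by unfold e; fun_prop

lemma integral_e (k : ℤ) : ∫ x, e (k * x) ∂mu1 = if k = 0 then 1 else 0 := by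
  unfold mu1
  rw [integral_Icc_eq_integral_Ioc, ← intervalIntegral.integral_of_le zero_le_one]
  split_ifs with h
  · simp [h, e]
  · have hc : (2 * Real.pi * Complex.I * k : ℂ) ≠ 0 := by
      simp [h, Real.pi_ne_zero]
    have := integral_exp_mul_complex (a := 0) (b := 1) hc
    have h2 : ∀ x : ℝ, e (k * x) = Complex.exp (2 * Real.pi * Complex.I * k * x) := by
      intro x; simp only [e]; congr 1; push_cast; ring
    simp only [h2, this]
    have h3 : Complex.exp (2 * Real.pi * Complex.I * k) = 1 := by
      rw [Complex.exp_eq_one_iff]; exact ⟨k, by ring⟩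
    simp [h3]

/-- two dimensional character -/
noncomputable def ch (p : ℤ × ℤ) (z : ℝ × ℝ) : ℂ := e (p.1 * z.1) * e (p.2 * z.2)

lemma ch_add (p q : ℤ × ℤ) (z) : ch (p + q) z = ch p z * ch q z := by
  simp only [ch, Prod.fst_add, Prod.snd_add, Int.cast_add, add_mul, e_add]; ring
lemma ch_conj (p : ℤ × ℤ) (z) : (starRingEnd ℂ) (ch p z) = ch (-p) z := by
  simp [ch, conj_e]
lemma norm_ch (p z) : ‖ch p z‖ = 1 := by simp [ch, norm_e]
@[fun_prop] lemma cont_ch (p) : Continuous (ch p) := by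
  have := cont_e
  unfold ch; fun_prop
lemma integral_ch (p : ℤ × ℤ) : ∫ z, ch p z ∂mu2 = if p = 0 then 1 else 0 := by
  unfold ch mu2
  rw [integral_prod_mul (fun x => e (p.1 * x)) (fun x => e (p.2 * x)), integral_e, integral_e]
  rcases p with ⟨a, b⟩
  by_cases h : a = 0 <;> by_cases h' : b = 0 <;> simp [h, h', Prod.ext_iff]

lemma integrable_cont {E : Type*} [NormedAddCommGroup E]
    {f : ℝ × ℝ → E} (hf : Continuous f) : Integrable f mu2 := by
  unfold mu2 mu1
  rw [Measure.prod_restrict]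
  exact hf.continuousOn.integrableOn_compact (isCompact_Icc.prod isCompact_Icc)

lemma parseval (T : Finset (ℤ × ℤ)) (c : ℤ × ℤ → ℂ) :
    ∫ z, ‖∑ p ∈ T, c p * ch p z‖ ^ 2 ∂mu2 = ∑ p ∈ T, ‖c p‖ ^ 2 := by
  have h1 : ∀ z, ((‖∑ p ∈ T, c p * ch p z‖ ^ 2 : ℝ) : ℂ) =
      ∑ p ∈ T, ∑ q ∈ T, c p * (starRingEnd ℂ) (c q) * ch (p - q) z := by
    intro z
    push_cast
    rw [← Complex.mul_conj', map_sum, Finset.sum_mul_sum]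
    refine Finset.sum_congr rfl fun p _ => Finset.sum_congr rfl fun q _ => ?_
    rw [map_mul, ch_conj, sub_eq_add_neg, ch_add]; ring
  have h2 : ((∫ z, ‖∑ p ∈ T, c p * ch p z‖ ^ 2 ∂mu2 : ℝ) : ℂ) = ((∑ p ∈ T, ‖c p‖ ^ 2 : ℝ) : ℂ) := by
    rw [← integral_complex_ofReal]
    simp_rw [h1]
    rw [integral_finsetSum _ (fun p _ => integrable_cont (by fun_prop))]
    push_cast
    refine Finset.sum_congr rfl fun p hp => ?_
    rw [integral_finsetSum _ (fun p _ => integrable_cont (by fun_prop))]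
    simp_rw [integral_const_mul, integral_ch, sub_eq_zero]
    simp [hp, Complex.mul_conj']
  exact_mod_cast h2

lemma bilin (S T : Finset (ℤ × ℤ)) (G : ℤ × ℤ → ℂ) (K : ℝ) 
    (hK : ∀ w, (((S ×ˢ T).filter (fun r => r.1 + r.2 = w)).card : ℝ) ≤ K) :
    ∫ z, (‖∑ p ∈ S, G p * ch p z‖ * ‖∑ p ∈ T, G p * ch p z‖) ^ 2 ∂mu2 ≤
      K * ((∑ p ∈ S, ‖G p‖ ^ 2) * ∑ p ∈ T, ‖G p‖ ^ 2) := by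
  set Z := (S ×ˢ T).image (fun r => r.1 + r.2) with hZ
  have hmaps : ∀ r ∈ S ×ˢ T, r.1 + r.2 ∈ Z := fun r hr => Finset.mem_image_of_mem _ hr
  have h1 : ∀ z, (‖∑ p ∈ S, G p * ch p z‖ * ‖∑ p ∈ T, G p * ch p z‖) ^ 2 =
     ‖∑ w ∈ Z, (∑ r ∈ (S ×ˢ T).filter (fun r => r.1 + r.2 = w), G r.1 * G r.2) * ch w z‖ ^ 2 := by
    intro z
    rw [← norm_mul, Finset.sum_mul_sum, ← Finset.sum_product', ← Finset.sum_fiberwise_of_maps_to hmaps]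
    congr 2
    refine Finset.sum_congr rfl fun w _ => ?_
    rw [Finset.sum_mul]
    refine Finset.sum_congr rfl fun r hr => ?_
    rw [← (Finset.mem_filter.1 hr).2, ch_add]; ring
  simp_rw [h1]
  rw [parseval]
  calc _ ≤ ∑ w ∈ Z, K * ∑ r ∈ (S ×ˢ T).filter (fun r => r.1 + r.2 = w), ‖G r.1‖ ^ 2 * ‖G r.2‖ ^ 2 := by
        refine Finset.sum_le_sum fun w _ => ?_
        calc _ ≤ (∑ r ∈ (S ×ˢ T).filter (fun r => r.1 + r.2 = w), ‖G r.1 * G r.2‖) ^ 2 := by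
              gcongr; exact norm_sum_le _ _
          _ ≤ _ := sq_sum_le_card_mul_sum_sq
          _ ≤ _ := by
              simp_rw [norm_mul, mul_pow]
              gcongr
              exact hK w
    _ = _ := by
        rw [← Finset.mul_sum, Finset.sum_fiberwise_of_maps_to hmaps 
          (fun r => ‖G r.1‖ ^ 2 * ‖G r.2‖ ^ 2), Finset.sum_mul_sum, Finset.sum_product]

lemma count_nonneg (T : Finset ℤ) (ξ c : ℤ) (s : ℕ) (hs : 1 ≤ s)
    (h0 : ∀ y ∈ T, 0 ≤ 2 * y - ξ) (h : ∀ y ∈ T, |(2 * y - ξ) ^ 2 - c| ≤ 4 * (s:ℤ) ^ 2) :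
    T.card ≤ 4 * s := by
  rcases T.eq_empty_or_nonempty with rfl | hne
  · simp
  have hm := T.min'_mem hne
  set m := T.min' hne with hmdef
  have hsub : T ⊆ Finset.Icc m (m + 2 * s) := by
    intro y hy
    have hmy : m ≤ y := T.min'_le y hy
    rw [Finset.mem_Icc]
    refine ⟨hmy, ?_⟩
    have a1 := abs_le.1 (h y hy)
    have a2 := abs_le.1 (h m hm)
    have a3 := h0 m hm
    by_contra hlt
    push Not at hlt
    have : (s:ℤ) ≥ 1 := by exact_mod_cast hs
    nlinarith [mul_nonneg a3 (sub_nonneg.2 hmy)]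
  have := Finset.card_le_card hsub
  simp at this
  omega

lemma count_sq (T : Finset ℤ) (ξ c : ℤ) (s : ℕ) (hs : 1 ≤ s)
    (h : ∀ y ∈ T, |(2 * y - ξ) ^ 2 - c| ≤ 4 * (s:ℤ) ^ 2) :
    T.card ≤ 8 * s := by
  have h1 := count_nonneg (T.filter (fun y => 0 ≤ 2 * y - ξ)) ξ c s hs
    (fun y hy => (Finset.mem_filter.1 hy).2) (fun y hy => h y (Finset.mem_filter.1 hy).1)
  have h2 := count_nonneg ((T.filter (fun y => ¬ 0 ≤ 2 * y - ξ)).image (fun y => -y)) (-ξ) c s hs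
    (by
      intro y hy
      obtain ⟨x, hx, rfl⟩ := Finset.mem_image.1 hy
      have := (Finset.mem_filter.1 hx).2
      omega)
    (by
      intro y hy
      obtain ⟨x, hx, rfl⟩ := Finset.mem_image.1 hy
      have := h x (Finset.mem_filter.1 hx).1
      convert this using 3
      ring)
  rw [Finset.card_image_of_injective _ neg_injective] at h2
  have := Finset.card_filter_add_card_filter_not (s := T) (fun y => 0 ≤ 2 * y - ξ)
  omega

/-- counting lemma -/
lemma count_pairs (R : Finset ((ℤ × ℤ) × (ℤ × ℤ))) (w : ℤ × ℤ) (M s : ℕ) (hM : 1 ≤ M) (hs : 1 ≤ s)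
    (hMs : M ≤ s ^ 2) (hw : ∀ r ∈ R, r.1 + r.2 = w)
    (h1 : ∀ r ∈ R, (r.1.2 - r.1.1 ^ 2).natAbs ≤ M)
    (h2 : ∀ r ∈ R, (r.2.2 - r.2.1 ^ 2).natAbs ≤ s ^ 2) :
    R.card ≤ 24 * M * s := by
  have hb : (R.image (fun r => r.1.1)).card ≤ 8 * s := by
    apply count_sq _ w.1 (2 * w.2 - w.1 ^ 2) s hs
    intro y hy
    obtain ⟨r, hr, rfl⟩ := Finset.mem_image.1 hy
    have a1 : |r.1.2 - r.1.1 ^ 2| ≤ M := by rw [← Int.natCast_natAbs]; exact_mod_cast h1 r hr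
    have a2 : |r.2.2 - r.2.1 ^ 2| ≤ (s:ℤ) ^ 2 := by
      have := h2 r hr
      rw [← Int.natCast_natAbs]; exact_mod_cast this
    have a3 : (M:ℤ) ≤ s ^ 2 := by exact_mod_cast hMs
    rw [abs_le] at *
    rw [← hw r hr]
    simp only [Prod.fst_add, Prod.snd_add]
    constructor <;> nlinarith
  have := Finset.card_le_mul_card_image (s := R) (f := fun r => r.1.1) (n := 3 * M) ?_
  · nlinarith
  · intro a _
    have hinj : Set.InjOn (fun r : (ℤ × ℤ) × (ℤ × ℤ) => r.1.2) (R.filter (fun r => r.1.1 = a)) := by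
      intro r hr r' hr' hrr
      simp only [Finset.coe_filter, Set.mem_ofPred_eq] at hr hr'
      have e1 := hw r hr.1
      have e2 := hw r' hr'.1
      rw [← e2] at e1
      have : r.1 = r'.1 := Prod.ext (hr.2.trans hr'.2.symm) hrr
      rw [this] at e1
      exact Prod.ext this (add_left_cancel e1)
    rw [← Finset.card_image_of_injOn hinj]
    have hsub : (R.filter (fun r => r.1.1 = a)).image (fun r => r.1.2) ⊆
        Finset.Icc (a ^ 2 - M) (a ^ 2 + M) := by
      intro y hy
      obtain ⟨r, hr, rfl⟩ := Finset.mem_image.1 hy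
      rw [Finset.mem_filter] at hr
      have := h1 r hr.1
      rw [hr.2] at this
      rw [Finset.mem_Icc]; constructor <;> omega
    refine (Finset.card_le_card hsub).trans ?_
    simp; omega

def lev (p : ℤ × ℤ) : ℕ := Nat.log 256 (p.2 - p.1 ^ 2).natAbs

lemma lev_lt (p : ℤ × ℤ) : (p.2 - p.1 ^ 2).natAbs ≤ 256 ^ (lev p + 1) :=
  (Nat.lt_pow_succ_log_self (by norm_num) _).le

noncomputable def dd (m n : ℕ) : ℝ := (1 / 2) ^ (max m n - min m n)

lemma dd_comm (m n : ℕ) : dd m n = dd n m := by simp [dd, max_comm, min_comm]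
lemma dd_pos (m n : ℕ) : 0 < dd m n := by unfold dd; positivity

lemma sum_dd (m L : ℕ) : ∑ n ∈ Finset.range L, dd m n ≤ 3 - (1 / 2) ^ m := by
  induction m generalizing L with
  | zero =>
    have : ∑ n ∈ Finset.range L, dd 0 n = ∑ n ∈ Finset.range L, (1 / 2 : ℝ) ^ n := by
      simp [dd]
    rw [this, geom_sum_eq (by norm_num)]
    have h0 : (0:ℝ) < (1/2) ^ L := by positivity
    rw [div_le_iff_of_neg (by norm_num)]
    norm_num at h0 ⊢
  | succ m ih =>
    cases L with
    | zero =>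
      have : ((1:ℝ)/2) ^ (m+1) ≤ 1 := pow_le_one₀ (by norm_num) (by norm_num)
      simp at *; linarith
    | succ L =>
      rw [Finset.sum_range_succ']
      have h1 : ∀ n, dd (m+1) (n+1) = dd m n := by
        intro n; unfold dd; congr 1; omega
      simp_rw [h1]
      have h2 : dd (m+1) 0 = (1/2) ^ (m+1) := by simp [dd]
      rw [h2]
      have := ih L
      have h3 : ((1:ℝ)/2) ^ m = 2 * (1/2) ^ (m+1) := by rw [pow_succ]; ring
      linarith

lemma count_lev (S : Finset (ℤ × ℤ)) (m n : ℕ) (w : ℤ × ℤ) :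
    ((((S.filter (fun p => lev p = m)) ×ˢ (S.filter (fun p => lev p = n))).filter
      (fun r => r.1 + r.2 = w)).card : ℝ) ≤ 98304 * (64 ^ m * 64 ^ n * dd m n ^ 2) := by
  wlog hmn : m ≤ n generalizing m n
  · have := this n m (by omega)
    rw [dd_comm, mul_comm ((64:ℝ)^m)]
    refine le_trans ?_ this
    norm_cast
    apply Finset.card_le_card_of_injOn (fun r => (r.2, r.1))
    · intro r hr
      simp at hr ⊢
      refine ⟨⟨hr.1.2, hr.1.1⟩, ?_⟩
      rw [add_comm]; exact hr.2
    · intro r _ r' _ h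
      simp at h
      exact Prod.ext h.2 h.1
  · have h := count_pairs (((S.filter (fun p => lev p = m)) ×ˢ (S.filter (fun p => lev p = n))).filter
      (fun r => r.1 + r.2 = w)) w (256 ^ (m+1)) (16 ^ (n+1)) (Nat.one_le_pow _ _ (by norm_num)) 
      (Nat.one_le_pow _ _ (by norm_num))
      (by 
        rw [← pow_mul, mul_comm, pow_mul]
        exact Nat.pow_le_pow_right (by norm_num) (by omega))
      (fun r hr => (Finset.mem_filter.1 hr).2)
      (by
        intro r hr
        simp only [Finset.mem_filter, Finset.mem_product] at hr
        have := lev_lt r.1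
        rwa [hr.1.1.2] at this)
      (by
        intro r hr
        simp only [Finset.mem_filter, Finset.mem_product] at hr
        have := lev_lt r.2
        rw [hr.1.2.2] at this
        rwa [← pow_mul, mul_comm, pow_mul])
    have h' : ((((S.filter (fun p => lev p = m)) ×ˢ (S.filter (fun p => lev p = n))).filter
      (fun r => r.1 + r.2 = w)).card : ℝ) ≤ 24 * 256 ^ (m+1) * 16 ^ (n+1) := by exact_mod_cast h
    refine h'.trans (le_of_eq ?_)
    obtain ⟨k, rfl⟩ := Nat.exists_eq_add_of_le hmn
    have : dd m (m + k) = (1/2) ^ k := by unfold dd; congr 1; omega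
    rw [this, ← pow_mul, mul_comm k 2, pow_mul]
    have e1 : (256:ℝ) ^ m = 4 ^ m * 64 ^ m := by rw [← mul_pow]; norm_num
    have e2 : (64:ℝ) ^ m = 4 ^ m * 16 ^ m := by rw [← mul_pow]; norm_num
    have e3 : (16:ℝ) ^ k = 64 ^ k * ((1/2)^2) ^ k := by rw [← mul_pow]; norm_num
    simp only [pow_add, e1, e3]
    rw [show (64:ℝ) ^ m * (64 ^ m * 64 ^ k) = 64 ^ m * ((4 ^ m * 16 ^ m) * 64 ^ k) by rw [← e2]]
    ring

theorem discrete (S : Finset (ℤ × ℤ)) (G : ℤ × ℤ → ℂ) :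
    ∫ z, ‖∑ p ∈ S, G p * ch p z‖ ^ 4 ∂mu2 ≤
      884736 * (∑ p ∈ S, 64 ^ lev p * ‖G p‖ ^ 2) ^ 2 := by
  set L := S.sup lev + 1 with hL
  have hmaps : ∀ p ∈ S, lev p ∈ Finset.range L := fun p hp => by
    have := Finset.le_sup (f := lev) hp
    simp; omega
  set P : ℕ → ℝ × ℝ → ℂ := fun m z => ∑ p ∈ S.filter (fun p => lev p = m), G p * ch p z with hP
  set N : ℕ → ℝ := fun m => ∑ p ∈ S.filter (fun p => lev p = m), ‖G p‖ ^ 2 with hN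
  have hN0 : ∀ m, 0 ≤ N m := fun m => by positivity
  set A : ℕ → ℝ := fun m => 8 ^ m * √(N m) with hA
  have hA0 : ∀ m, 0 ≤ A m := fun m => by positivity
  have hA2 : ∀ m, A m ^ 2 = 64 ^ m * N m := fun m => by
    simp only [hA, mul_pow, Real.sq_sqrt (hN0 m), ← pow_mul]
    rw [mul_comm m 2, pow_mul]; norm_num
  set c : ℕ × ℕ → ℝ := fun i => dd i.1 i.2 * (A i.1 * A i.2) with hc
  have hc0 : ∀ i, 0 ≤ c i := fun i => mul_nonneg (dd_pos _ _).le (mul_nonneg (hA0 _) (hA0 _))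
  set J := Finset.range L ×ˢ Finset.range L with hJ
  have hPz : ∀ m, A m = 0 → ∀ z, P m z = 0 := by
    intro m hm z
    have : N m = 0 := by
      have := hA2 m
      rw [hm] at this
      have h64 : (64:ℝ) ^ m ≠ 0 := by positivity
      simpa [h64] using this.symm
    rw [hN] at this
    simp only at this
    rw [Finset.sum_eq_zero_iff_of_nonneg (fun _ _ => by positivity)] at this
    apply Finset.sum_eq_zero
    intro p hp
    have := this p hp
    simp at this
    simp [this]
  have hcz : ∀ i z, c i = 0 → ‖P i.1 z‖ * ‖P i.2 z‖ = 0 := by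
    intro i z h
    have h3 := (dd_pos i.1 i.2).ne'
    simp only [hc, mul_eq_zero, h3, false_or] at h
    rcases h with h | h
    · simp [hPz _ h]
    · simp [hPz _ h]
  have hpt : ∀ z, ‖∑ p ∈ S, G p * ch p z‖ ^ 4 ≤
      (∑ i ∈ J, c i) * ∑ i ∈ J, (‖P i.1 z‖ * ‖P i.2 z‖) ^ 2 / c i := by
    intro z
    have h1 : ‖∑ p ∈ S, G p * ch p z‖ ≤ ∑ m ∈ Finset.range L, ‖P m z‖ := by
      rw [← Finset.sum_fiberwise_of_maps_to hmaps]
      exact norm_sum_le _ _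
    have h2 : ‖∑ p ∈ S, G p * ch p z‖ ^ 2 ≤ ∑ i ∈ J, ‖P i.1 z‖ * ‖P i.2 z‖ := by
      rw [hJ, Finset.sum_product]
      simp only
      rw [← Finset.sum_mul_sum, sq]
      gcongr
    calc _ = (‖∑ p ∈ S, G p * ch p z‖ ^ 2) ^ 2 := by ring
      _ ≤ (∑ i ∈ J, ‖P i.1 z‖ * ‖P i.2 z‖) ^ 2 := by gcongr
      _ ≤ _ := by
        apply Finset.sum_sq_le_sum_mul_sum_of_sq_le_mul
        · intro i _; exact hc0 i
        · intro i _; have := hc0 i; positivity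
        · intro i _
          by_cases h : c i = 0
          · simp [hcz i z h, h]
          · apply le_of_eq; field_simp
  have hPc : ∀ m, Continuous (P m) := fun m => by simp only [hP]; fun_prop
  have hint : ∫ z, ‖∑ p ∈ S, G p * ch p z‖ ^ 4 ∂mu2 ≤ 
      (∑ i ∈ J, c i) * ∑ i ∈ J, 98304 * c i := by
    calc _ ≤ ∫ z, (∑ i ∈ J, c i) * ∑ i ∈ J, (‖P i.1 z‖ * ‖P i.2 z‖) ^ 2 / c i ∂mu2 := by
          apply integral_mono (integrable_cont (by fun_prop)) (integrable_cont (by fun_prop)) hpt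
      _ = (∑ i ∈ J, c i) * ∑ i ∈ J, (∫ z, (‖P i.1 z‖ * ‖P i.2 z‖) ^ 2 ∂mu2) / c i := by
          rw [integral_const_mul, integral_finsetSum _ (fun i _ => integrable_cont (by fun_prop))]
          simp_rw [integral_div]
      _ ≤ _ := by
          refine mul_le_mul_of_nonneg_left (Finset.sum_le_sum fun i _ => ?_) 
            (Finset.sum_nonneg fun i _ => hc0 i)
          apply div_le_of_le_mul₀ (hc0 i) (by have := hc0 i; positivity)
          refine (bilin _ _ G _ (count_lev S i.1 i.2)).trans (le_of_eq ?_)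
          have : c i * c i = dd i.1 i.2 ^ 2 * (A i.1 ^ 2 * A i.2 ^ 2) := by simp only [hc]; ring
          rw [mul_assoc 98304 (c i), this, hA2, hA2]
          ring
  have hsum : ∑ m ∈ Finset.range L, A m ^ 2 = ∑ p ∈ S, 64 ^ lev p * ‖G p‖ ^ 2 := by
    rw [← Finset.sum_fiberwise_of_maps_to hmaps]
    refine Finset.sum_congr rfl fun m _ => ?_
    rw [hA2, hN, Finset.mul_sum]
    refine Finset.sum_congr rfl fun p hp => ?_
    rw [(Finset.mem_filter.1 hp).2]
  have hdd : ∀ m, ∑ n ∈ Finset.range L, dd m n ≤ 3 := fun m =>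
    (sum_dd m L).trans (by have : (0:ℝ) ≤ (1/2) ^ m := by positivity
                           linarith)
  have hcs : ∑ i ∈ J, c i ≤ 3 * ∑ m ∈ Finset.range L, A m ^ 2 := by
    have e1 : ∑ m ∈ Finset.range L, ∑ n ∈ Finset.range L, dd m n * A m ^ 2 ≤ 
        3 * ∑ m ∈ Finset.range L, A m ^ 2 := by
      rw [Finset.mul_sum]
      refine Finset.sum_le_sum fun m _ => ?_
      rw [← Finset.sum_mul]
      exact mul_le_mul_of_nonneg_right (hdd m) (sq_nonneg _)
    have e2 : ∑ m ∈ Finset.range L, ∑ n ∈ Finset.range L, dd m n * A n ^ 2 ≤ 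
        3 * ∑ m ∈ Finset.range L, A m ^ 2 := by
      rw [Finset.sum_comm]
      simp_rw [fun m n => dd_comm m n]
      refine le_trans (le_of_eq ?_) e1
      refine Finset.sum_congr rfl fun m _ => Finset.sum_congr rfl fun n _ => ?_
      rw [dd_comm]
    have e3 : ∑ i ∈ J, c i ≤ ∑ m ∈ Finset.range L, ∑ n ∈ Finset.range L, 
        (dd m n * A m ^ 2 + dd m n * A n ^ 2) / 2 := by
      rw [hJ, Finset.sum_product]
      refine Finset.sum_le_sum fun m _ => Finset.sum_le_sum fun n _ => ?_
      simp only [hc]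
      nlinarith [mul_nonneg (dd_pos m n).le (sq_nonneg (A m - A n))]
    simp_rw [← Finset.sum_div, Finset.sum_add_distrib] at e3
    linarith
  rw [hsum] at hcs
  refine hint.trans ?_
  rw [← Finset.mul_sum]
  have : 0 ≤ ∑ i ∈ J, c i := Finset.sum_nonneg fun i _ => hc0 i
  nlinarith

theorem discrete_enn (S : Finset (ℤ × ℤ)) (G : ℤ × ℤ → ℂ) :
    ∫⁻ z, ‖∑ p ∈ S, G p * ch p z‖ₑ ^ 4 ∂mu2 ≤
      884736 * (∑ p ∈ S, 64 ^ lev p * ‖G p‖ₑ ^ 2) ^ 2 := by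
  have h1 := ENNReal.ofReal_le_ofReal (discrete S G)
  rw [ofReal_integral_eq_lintegral_ofReal (integrable_cont (by fun_prop))
    (Filter.Eventually.of_forall fun z => by positivity)] at h1
  convert h1 using 1
  · refine lintegral_congr fun z => ?_
    rw [ENNReal.ofReal_pow (norm_nonneg _), ofReal_norm]
  · rw [ENNReal.ofReal_mul (by norm_num), ENNReal.ofReal_pow (by positivity),
      ENNReal.ofReal_sum_of_nonneg (fun _ _ => by positivity)]
    congr 1
    · simp
    · congr 1
      refine Finset.sum_congr rfl fun p _ => ?_
      rw [ENNReal.ofReal_mul (by positivity), ENNReal.ofReal_pow (norm_nonneg _), ofReal_norm,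
        ENNReal.ofReal_pow (by norm_num)]
      simp

lemma minkowski4 {α β : Type*} [MeasurableSpace α] [MeasurableSpace β] (μ : Measure α) (ν : Measure β)
    [SFinite μ] [SFinite ν] (F : α → β → ℝ≥0∞) (hF : Measurable (Function.uncurry F))
    (hfin : ∫⁻ z, (∫⁻ θ, F z θ ∂ν) ^ 4 ∂μ ≠ ⊤) :
    ∫⁻ z, (∫⁻ θ, F z θ ∂ν) ^ 4 ∂μ ≤ (∫⁻ θ, (∫⁻ z, F z θ ^ 4 ∂μ) ^ ((1:ℝ)/4) ∂ν) ^ 4 := by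
  set u : α → ℝ≥0∞ := fun z => ∫⁻ θ, F z θ ∂ν with hu
  have hum : Measurable u := hF.lintegral_prod_right'
  set X := ∫⁻ z, u z ^ 4 ∂μ with hX
  set B := ∫⁻ θ, (∫⁻ z, F z θ ^ 4 ∂μ) ^ ((1:ℝ)/4) ∂ν with hB
  have hFz : ∀ z, Measurable (F z) := fun z => hF.comp measurable_prodMk_left
  have hFθ : ∀ θ, Measurable (fun z => F z θ) := fun θ => hF.comp measurable_prodMk_right
  have hF' : Measurable (fun r : α × β => F r.1 r.2) := hF
  have key : X ≤ X ^ ((3:ℝ)/4) * B := by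
    calc X = ∫⁻ z, ∫⁻ θ, u z ^ 3 * F z θ ∂ν ∂μ := by
          refine lintegral_congr fun z => ?_
          rw [lintegral_const_mul _ (hFz z), ← pow_succ]
      _ = ∫⁻ θ, ∫⁻ z, u z ^ 3 * F z θ ∂μ ∂ν := by
          rw [lintegral_lintegral_swap]
          exact (((hum.comp measurable_fst).pow_const 3).mul hF').aemeasurable
      _ ≤ ∫⁻ θ, X ^ ((3:ℝ)/4) * (∫⁻ z, F z θ ^ 4 ∂μ) ^ ((1:ℝ)/4) ∂ν := by
          refine lintegral_mono fun θ => ?_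
          have hpq : ((4:ℝ)/3).HolderConjugate 4 := by
            rw [Real.holderConjugate_iff]; norm_num
          have := ENNReal.lintegral_mul_le_Lp_mul_Lq μ hpq (f := fun z => u z ^ 3)
            (g := fun z => F z θ) (hum.pow_const 3).aemeasurable (hFθ θ).aemeasurable
          refine this.trans (le_of_eq ?_)
          have e1 : ∀ z, (u z ^ 3) ^ ((4:ℝ)/3) = u z ^ 4 := fun z => by
            rw [← ENNReal.rpow_natCast, ← ENNReal.rpow_mul, ← ENNReal.rpow_natCast]; norm_num
          have e2 : ∀ z, (F z θ) ^ (4:ℝ) = F z θ ^ 4 := fun z => by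
            rw [← ENNReal.rpow_natCast]; norm_num
          simp_rw [e1, e2]
          norm_num [hX]
      _ = _ := by
          rw [lintegral_const_mul']
          exact ENNReal.rpow_ne_top_of_nonneg (by norm_num) hfin
  by_cases h0 : X = 0
  · rw [h0]; exact zero_le
  have h1 : X ^ ((1:ℝ)/4) ≤ B := by
    have e : X = X ^ ((3:ℝ)/4) * X ^ ((1:ℝ)/4) := by
      rw [← ENNReal.rpow_add _ _ h0 hfin]; norm_num
    replace key := e.symm.trans_le key
    refine (ENNReal.mul_le_mul_iff_right ?_ ?_).1 key
    · simp only [ne_eq, ENNReal.rpow_eq_zero_iff, h0, hfin, false_and, or_self, not_false_eq_true]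
    · exact ENNReal.rpow_ne_top_of_nonneg (by norm_num) hfin
  calc X = (X ^ ((1:ℝ)/4)) ^ 4 := by
        rw [← ENNReal.rpow_natCast, ← ENNReal.rpow_mul]; norm_num
    _ ≤ _ := by gcongr

lemma jensen_sqrt {β : Type*} [MeasurableSpace β] (ν : Measure β) [IsProbabilityMeasure ν]
    (Y : β → ℝ≥0∞) (hY : Measurable Y) : (∫⁻ θ, Y θ ^ ((1:ℝ)/2) ∂ν) ^ 2 ≤ ∫⁻ θ, Y θ ∂ν := by
  have h22 : (2:ℝ).HolderConjugate 2 := by rw [Real.holderConjugate_iff]; norm_num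
  have := ENNReal.lintegral_mul_le_Lp_mul_Lq ν h22 (f := fun θ => Y θ ^ ((1:ℝ)/2))
            (g := fun z => 1) (hY.pow_const _).aemeasurable aemeasurable_const
  have e1 : ∀ z, (Y z ^ ((1:ℝ)/2)) ^ (2:ℝ) = Y z := fun z => by
    rw [← ENNReal.rpow_mul]; norm_num
  simp_rw [e1] at this
  simp only [Pi.mul_apply, mul_one, ENNReal.one_rpow, lintegral_const, measure_univ] at this
  calc _ ≤ ((∫⁻ θ, Y θ ∂ν) ^ ((1:ℝ)/2)) ^ 2 := by gcongr
    _ = _ := by rw [← ENNReal.rpow_natCast, ← ENNReal.rpow_mul]; norm_num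

noncomputable def nu : Measure ℝ := volume.restrict (Set.Ioc (0:ℝ) 1)
instance : IsProbabilityMeasure nu := ⟨by simp [nu]⟩

lemma lint_shift (φ : ℝ → ℝ≥0∞) (n : ℤ) :
    ∫⁻ θ, φ (n + θ) ∂nu = ∫⁻ l in Set.Ioc (n:ℝ) (n + 1), φ l := by
  have := (measurePreserving_add_left volume (n:ℝ)).setLIntegral_comp_preimage_emb
    (measurableEmbedding_addLeft (n:ℝ)) φ (Set.Ioc (n:ℝ) (n + 1))
  rw [← this]; simp [nu]

lemma int_shift (φ : ℝ → ℂ) (n : ℤ) :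
    ∫ θ, φ (n + θ) ∂nu = ∫ l in Set.Ioc (n:ℝ) (n + 1), φ l := by
  have := (measurePreserving_add_left volume (n:ℝ)).setIntegral_preimage_emb
    (measurableEmbedding_addLeft (n:ℝ)) φ (Set.Ioc (n:ℝ) (n + 1))
  rw [← this]; simp [nu]

lemma integrable_shift (φ : ℝ → ℂ) (hφ : Integrable φ) (n : ℤ) :
    Integrable (fun θ => φ (n + θ)) nu :=
  (hφ.comp_add_left (n:ℝ)).integrableOn

lemma sum_lint_shift (φ : ℝ → ℝ≥0∞) (T : Finset ℤ) :
    ∑ n ∈ T, ∫⁻ θ, φ (n + θ) ∂nu ≤ ∫⁻ l, φ l := by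
  simp_rw [lint_shift]
  rw [← lintegral_biUnion_finset]
  · exact setLIntegral_le_lintegral _ _
  · intro a _ b _ hab
    exact Set.pairwise_disjoint_Ioc_intCast ℝ hab
  · intro b _; exact measurableSet_Ioc

noncomputable def wt (ξ : ℤ) (l : ℝ) : ℝ := Real.sqrt (1 + (l - (ξ : ℝ) ^ 2) ^ 2) ^ ((3:ℝ)/4)

lemma lev_le (ξ n : ℤ) (θ : ℝ) (h0 : 0 ≤ θ) (h1 : θ ≤ 1) :
    (64:ℝ) ^ lev (ξ, n) ≤ 2 * wt ξ (n + θ) := by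
  set s := Real.sqrt (1 + ((n + θ : ℝ) - (ξ : ℝ) ^ 2) ^ 2) with hs
  have hs1 : 1 ≤ s := Real.one_le_sqrt.2 (by nlinarith [sq_nonneg ((n + θ : ℝ) - (ξ : ℝ) ^ 2)])
  have hs2 : |(n + θ : ℝ) - (ξ : ℝ) ^ 2| ≤ s := Real.abs_le_sqrt (by linarith)
  have h256 : (256:ℝ) ^ lev (ξ, n) ≤ 2 * s := by
    by_cases hz : n - ξ ^ 2 = 0
    · simp [lev, hz]; linarith
    · have h := Nat.pow_log_le_self 256 (x := (n - ξ ^ 2).natAbs) (by simpa using hz)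
      have h' : (256:ℝ) ^ lev (ξ, n) ≤ ((n - ξ ^ 2).natAbs : ℝ) := by
        unfold lev; exact_mod_cast h
      have h2 : ((n - ξ ^ 2).natAbs : ℝ) = |(n:ℝ) - (ξ:ℝ) ^ 2| := by
        rw [Nat.cast_natAbs]; push_cast; rfl
      rw [h2] at h'
      refine h'.trans ?_
      rw [abs_le] at *
      constructor <;> linarith
  have e1 : (64:ℝ) ^ lev (ξ, n) = ((256:ℝ) ^ lev (ξ, n)) ^ ((3:ℝ)/4) := by
    rw [← Real.rpow_natCast, ← Real.rpow_natCast, ← Real.rpow_mul (by norm_num), mul_comm,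
      Real.rpow_mul (by norm_num)]
    congr 1
    rw [show (256:ℝ) = 4 ^ (4:ℝ) by norm_num, ← Real.rpow_mul (by norm_num)]
    norm_num
  rw [e1]
  calc _ ≤ (2 * s) ^ ((3:ℝ)/4) := by gcongr
    _ = 2 ^ ((3:ℝ)/4) * s ^ ((3:ℝ)/4) := Real.mul_rpow (by norm_num) (by linarith)
    _ ≤ 2 ^ (1:ℝ) * s ^ ((3:ℝ)/4) := by
        gcongr <;> norm_num
    _ = _ := by rw [Real.rpow_one]; rfl

noncomputable def FF (g : ℤ → ℝ → ℂ) (S T : Finset ℤ) (z : ℝ × ℝ) (θ : ℝ) : ℂ :=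
  ∑ p ∈ S ×ˢ T, g p.1 (p.2 + θ) * ch p z

noncomputable def fST (g : ℤ → ℝ → ℂ) (S T : Finset ℤ) (z : ℝ × ℝ) : ℂ :=
  ∑ ξ ∈ S, e (ξ * z.1) * ∑ n ∈ T, ∫ l in Set.Ioc (n:ℝ) (n + 1), g ξ l * e (l * z.2)

lemma integrable_mul_e {g : ℝ → ℂ} (hg : Integrable g) (t : ℝ) : Integrable (fun l => g l * e (l * t)) := by
  refine hg.mul_bdd (c := 1) ?_ (Filter.Eventually.of_forall fun l => (norm_e _).le)
  have := cont_e
  exact (by fun_prop : Continuous fun l : ℝ => e (l * t)).aestronglyMeasurable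

lemma fST_eq (g : ℤ → ℝ → ℂ) (hg : ∀ ξ, Integrable (g ξ)) (S T : Finset ℤ) (z : ℝ × ℝ) :
    fST g S T z = ∫ θ, e (θ * z.2) * FF g S T z θ ∂nu := by
  have h : ∀ θ, e (θ * z.2) * FF g S T z θ = 
      ∑ p ∈ S ×ˢ T, e (p.1 * z.1) * (g p.1 (p.2 + θ) * e ((p.2 + θ) * z.2)) := by
    intro θ
    rw [FF, Finset.mul_sum]
    refine Finset.sum_congr rfl fun p _ => ?_
    rw [add_mul, e_add, ch]; ring
  simp_rw [h]
  rw [integral_finsetSum, Finset.sum_product]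
  · unfold fST
    refine Finset.sum_congr rfl fun ξ _ => ?_
    rw [Finset.mul_sum]
    refine Finset.sum_congr rfl fun n _ => ?_
    rw [integral_const_mul, int_shift (fun l => g ξ l * e (l * z.2))]
  · intro p _
    exact (integrable_shift _ (integrable_mul_e (hg p.1) z.2) p.2).const_mul _

lemma est_ST (g : ℤ → ℝ → ℂ) (hg : ∀ ξ, Integrable (g ξ)) (hm : ∀ ξ, Measurable (g ξ)) (S T : Finset ℤ) :
    ∫⁻ z, ‖fST g S T z‖ₑ ^ 4 ∂mu2 ≤ 
      884736 * (2 * ∑' ξ, ∫⁻ l, ENNReal.ofReal (wt ξ l * ‖g ξ l‖ ^ 2)) ^ 2 := by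
  set X := ∑' ξ, ∫⁻ l, ENNReal.ofReal (wt ξ l * ‖g ξ l‖ ^ 2) with hX
  set F : ℝ × ℝ → ℝ → ℝ≥0∞ := fun z θ => ‖FF g S T z θ‖ₑ with hF
  have hFm : Measurable (Function.uncurry F) := by
    have : Measurable (fun r : (ℝ × ℝ) × ℝ => FF g S T r.1 r.2) := by
      unfold FF
      refine Finset.measurable_sum _ fun p _ => ?_
      exact ((hm p.1).comp (by fun_prop)).mul ((cont_ch p).measurable.comp measurable_fst)
    exact this.enorm
  have hu : ∀ z, ‖fST g S T z‖ₑ ≤ ∫⁻ θ, F z θ ∂nu := by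
    intro z
    rw [fST_eq g hg]
    refine (enorm_integral_le_lintegral_enorm _).trans (le_of_eq ?_)
    refine lintegral_congr fun θ => ?_
    rw [enorm_mul]
    have : ‖e (θ * z.2)‖ₑ = 1 := by rw [← ofReal_norm, norm_e]; simp
    rw [this, one_mul]
  have hfin : ∫⁻ z, (∫⁻ θ, F z θ ∂nu) ^ 4 ∂mu2 ≠ ⊤ := by
    set D := ∑ p ∈ S ×ˢ T, ∫⁻ θ, ‖g p.1 (p.2 + θ)‖ₑ ∂nu with hD
    have hD' : D ≠ ⊤ := by
      rw [hD, ENNReal.sum_ne_top]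
      intro p _
      exact (integrable_shift _ (hg p.1) p.2).2.ne
    have hb : ∀ z, ∫⁻ θ, F z θ ∂nu ≤ D := by
      intro z
      rw [hD, ← lintegral_finsetSum]
      · refine lintegral_mono fun θ => ?_
        refine (enorm_sum_le _ _).trans (le_of_eq ?_)
        refine Finset.sum_congr rfl fun p _ => ?_
        have : ‖ch p z‖ₑ = 1 := by rw [← ofReal_norm, norm_ch]; simp
        rw [enorm_mul, this, mul_one]
      · intro p _
        exact ((hm p.1).comp (by fun_prop)).enorm
    have : ∫⁻ z, (∫⁻ θ, F z θ ∂nu) ^ 4 ∂mu2 ≤ ∫⁻ z, D ^ 4 ∂mu2 := by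
      refine lintegral_mono fun z => ?_
      have := hb z
      gcongr
    refine ne_top_of_le_ne_top ?_ this
    simp [hD']
  set Y : ℝ → ℝ≥0∞ := fun θ => ∑ p ∈ S ×ˢ T, 64 ^ lev p * ‖g p.1 (p.2 + θ)‖ₑ ^ 2 with hY
  have hYm : Measurable Y := by
    refine Finset.measurable_sum _ fun p _ => ?_
    exact (((hm p.1).comp (by fun_prop)).enorm.pow_const 2).const_mul _
  have hYX : ∫⁻ θ, Y θ ∂nu ≤ 2 * X := by
    calc ∫⁻ θ, Y θ ∂nu ≤ ∫⁻ θ, ∑ p ∈ S ×ˢ T, 2 * ENNReal.ofReal (wt p.1 (p.2 + θ) * ‖g p.1 (p.2 + θ)‖ ^ 2) ∂nu := by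
          refine lintegral_mono_ae ?_
          filter_upwards [ae_restrict_mem measurableSet_Ioc] with θ hθ
          refine Finset.sum_le_sum fun p _ => ?_
          have h := ENNReal.ofReal_le_ofReal (mul_le_mul_of_nonneg_right 
            (lev_le p.1 p.2 θ hθ.1.le hθ.2) (sq_nonneg ‖g p.1 (p.2 + θ)‖))
          rw [ENNReal.ofReal_mul (by positivity), mul_assoc 2, ENNReal.ofReal_mul (by norm_num),
            ENNReal.ofReal_pow (by norm_num), ENNReal.ofReal_pow (norm_nonneg _), ofReal_norm] at h
          simpa using h
      _ = ∑ ξ ∈ S, ∑ n ∈ T, ∫⁻ θ, 2 * ENNReal.ofReal (wt ξ (n + θ) * ‖g ξ (n + θ)‖ ^ 2) ∂nu := by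
          rw [lintegral_finsetSum, Finset.sum_product]
          intro p _
          have := (hm p.1).comp (measurable_const_add (p.2:ℝ))
          have h2 : Measurable (fun θ : ℝ => wt p.1 (p.2 + θ)) := by unfold wt; fun_prop
          exact ((h2.mul (this.norm.pow_const 2)).ennreal_ofReal).const_mul _
      _ ≤ ∑ ξ ∈ S, ∫⁻ l, 2 * ENNReal.ofReal (wt ξ l * ‖g ξ l‖ ^ 2) := by
          refine Finset.sum_le_sum fun ξ _ => ?_
          exact sum_lint_shift (fun l => 2 * ENNReal.ofReal (wt ξ l * ‖g ξ l‖ ^ 2)) T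
      _ = 2 * ∑ ξ ∈ S, ∫⁻ l, ENNReal.ofReal (wt ξ l * ‖g ξ l‖ ^ 2) := by
          rw [Finset.mul_sum]
          refine Finset.sum_congr rfl fun ξ _ => ?_
          rw [lintegral_const_mul' _ _ (by norm_num)]
      _ ≤ _ := by
          gcongr
          exact ENNReal.sum_le_tsum S
  calc _ ≤ ∫⁻ z, (∫⁻ θ, F z θ ∂nu) ^ 4 ∂mu2 := by
        refine lintegral_mono fun z => ?_
        have := hu z
        gcongr
    _ ≤ _ := minkowski4 mu2 nu F hFm hfin
    _ ≤ (∫⁻ θ, 884736 ^ ((1:ℝ)/4) * Y θ ^ ((1:ℝ)/2) ∂nu) ^ 4 := by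
        gcongr with θ
        have := discrete_enn (S ×ˢ T) (fun p => g p.1 (p.2 + θ))
        calc _ ≤ (884736 * Y θ ^ 2) ^ ((1:ℝ)/4) := by
              apply ENNReal.rpow_le_rpow _ (by norm_num)
              exact this
          _ = _ := by
              rw [ENNReal.mul_rpow_of_nonneg _ _ (by norm_num), ← ENNReal.rpow_natCast, 
                ← ENNReal.rpow_mul]
              norm_num
    _ = 884736 * ((∫⁻ θ, Y θ ^ ((1:ℝ)/2) ∂nu) ^ 2) ^ 2 := by
        rw [lintegral_const_mul' _ _ (ENNReal.rpow_ne_top_of_nonneg (by norm_num) (by norm_num)),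
          mul_pow, ← pow_mul, ← ENNReal.rpow_natCast, ← ENNReal.rpow_mul]
        norm_num
    _ ≤ _ := by
        gcongr
        exact (jensen_sqrt nu Y hYm).trans hYX

lemma fatou {ι : Type*} [Countable ι] [Preorder ι] [IsDirectedOrder ι] [Nonempty ι] 
    (f : ι → ℝ × ℝ → ℝ≥0∞) (F : ℝ × ℝ → ℝ≥0∞)
    (hf : ∀ i, Measurable (f i)) (B : ℝ≥0∞) (hB : ∀ i, ∫⁻ z, f i z ∂mu2 ≤ B) 
    (hlim : ∀ z, F z ≤ Filter.liminf (fun i => f i z) Filter.atTop) :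
    ∫⁻ z, F z ∂mu2 ≤ B ∧ ∫⁻ x, ∫⁻ t, F (x, t) ∂mu1 ∂mu1 ≤ B := by
  have h1 : ∫⁻ z, Filter.liminf (fun i => f i z) Filter.atTop ∂mu2 ≤ B := by
    refine (lintegral_liminf_le hf).trans ?_
    refine Filter.liminf_le_of_le (by isBoundedDefault) fun b hb => ?_
    obtain ⟨i, hi⟩ := hb.exists
    exact hi.trans (hB i)
  refine ⟨(lintegral_mono hlim).trans h1, ?_⟩
  refine le_trans (lintegral_mono fun x => lintegral_mono fun t => hlim (x, t)) ?_
  refine le_trans (le_of_eq ?_) h1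
  unfold mu2
  rw [lintegral_prod]
  exact (Measurable.liminf' hf Filter.atTop_countable_basis fun _ => Set.to_countable _).aemeasurable

noncomputable def aa (g : ℤ → ℝ → ℂ) (ξ : ℤ) (t : ℝ) : ℂ := ∫ l, g ξ l * e (l * t)

lemma meas_int (φ : ℝ → ℂ) (hφ : Measurable φ) (s : Set ℝ) : 
    Measurable (fun t : ℝ => ∫ l in s, φ l * e (l * t)) := by
  have h : Measurable (fun r : ℝ × ℝ => φ r.2 * e (r.2 * r.1)) := 
    (hφ.comp measurable_snd).mul (cont_e.measurable.comp (by fun_prop))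
  exact (h.stronglyMeasurable.integral_prod_right' (ν := volume.restrict s)).measurable

theorem est_good (g : ℤ → ℝ → ℂ) (hg : ∀ ξ, Integrable (g ξ)) (hm : ∀ ξ, Measurable (g ξ)) :
    ∫⁻ x, ∫⁻ t, ‖∑' ξ : ℤ, e (ξ * x) * aa g ξ t‖ₑ ^ 4 ∂mu1 ∂mu1 ≤ 
      884736 * (2 * ∑' ξ, ∫⁻ l, ENNReal.ofReal (wt ξ l * ‖g ξ l‖ ^ 2)) ^ 2 := by
  have hem : Measurable e := cont_e.measurable
  have ham : ∀ ξ, Measurable (aa g ξ) := by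
    intro ξ
    have := meas_int (g ξ) (hm ξ) Set.univ
    rw [Measure.restrict_univ] at this
    exact this
  refine (fatou (ι := Finset ℤ) (fun S z => ‖∑ ξ ∈ S, e (ξ * z.1) * aa g ξ z.2‖ₑ ^ 4)
    (fun z => ‖∑' ξ : ℤ, e (ξ * z.1) * aa g ξ z.2‖ₑ ^ 4) ?_ _ ?_ ?_).2
  · intro S
    have : Measurable (fun z : ℝ × ℝ => ∑ ξ ∈ S, e (ξ * z.1) * aa g ξ z.2) := 
      Finset.measurable_sum _ fun ξ _ => 
        (hem.comp (by fun_prop)).mul ((ham ξ).comp measurable_snd)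
    exact this.enorm.pow_const 4
  · intro S
    refine (fatou (ι := Finset ℤ) (fun T z => ‖fST g S T z‖ₑ ^ 4) _ ?_ _ 
      (fun T => est_ST g hg hm S T) ?_).1
    · intro T
      have : Measurable (fST g S T) := by
        unfold fST
        refine Finset.measurable_sum _ fun ξ _ => 
          (hem.comp (by fun_prop)).mul (Finset.measurable_sum _ fun n _ => ?_)
        exact (meas_int (g ξ) (hm ξ) _).comp measurable_snd
      exact this.enorm.pow_const 4
    · intro z
      have : Filter.Tendsto (fun T => fST g S T z) Filter.atTop 
          (nhds (∑ ξ ∈ S, e (ξ * z.1) * aa g ξ z.2)) := by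
        unfold fST
        refine tendsto_finsetSum _ fun ξ _ => Filter.Tendsto.const_mul _ ?_
        have h := hasSum_integral_iUnion (μ := volume) (f := fun l => g ξ l * e (l * z.2)) 
          (s := fun n : ℤ => Set.Ioc (n:ℝ) (n + 1)) (fun _ => measurableSet_Ioc) 
          (Set.pairwise_disjoint_Ioc_intCast ℝ) (integrable_mul_e (hg ξ) z.2).integrableOn
        rw [iUnion_Ioc_intCast, setIntegral_univ] at h
        exact h
      exact (((ENNReal.continuous_pow 4).tendsto _).comp (this.enorm)).liminf_eq.ge
  · intro z
    by_cases hs : Summable (fun ξ : ℤ => e (ξ * z.1) * aa g ξ z.2)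
    · have := hs.hasSum
      exact (((ENNReal.continuous_pow 4).tendsto _).comp (Filter.Tendsto.enorm this)).liminf_eq.ge
    · simp [tsum_eq_zero_of_not_summable hs]
end Stri

/-- The Strichartz estimate `X^{0,3/8} ⊂ L⁴(T × [0,1])`:
`‖f‖_{L⁴(T×[0,1])} ≤ c ‖g‖_{0,3/8}`. -/
theorem strichartz_L4_one_dim :
    ∃ c > (0 : ℝ), ∀ g : ℤ → ℝ → ℂ, XNorm038 g < ⊤ →
      (∫⁻ x in Set.Icc (0:ℝ) 1, ∫⁻ t in Set.Icc (0:ℝ) 1,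
          ENNReal.ofReal (‖spacetimeFn g x t‖ ^ 4)) ^ ((1:ℝ)/4)
        ≤ ENNReal.ofReal c * XNorm038 g := by
  classical
  refine ⟨44, by norm_num, fun g _ => ?_⟩
  set g' : ℤ → ℝ → ℂ := fun ξ => if h : Integrable (g ξ) then h.1.mk (g ξ) else 0 with hg'
  have hmeas : ∀ ξ, Measurable (g' ξ) := by
    intro ξ
    by_cases h : Integrable (g ξ)
    · simp only [hg', dif_pos h]; exact h.1.stronglyMeasurable_mk.measurable
    · simp only [hg', dif_neg h]; exact measurable_zero
  have hint : ∀ ξ, Integrable (g' ξ) := by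
    intro ξ
    by_cases h : Integrable (g ξ)
    · simp only [hg', dif_pos h]; exact h.congr h.1.ae_eq_mk
    · simp only [hg', dif_neg h]; exact integrable_zero _ _ _
  have hX : ∀ ξ, ∫⁻ l, ENNReal.ofReal (Stri.wt ξ l * ‖g' ξ l‖ ^ 2) ≤
      ∫⁻ l, ENNReal.ofReal (Stri.wt ξ l * ‖g ξ l‖ ^ 2) := by
    intro ξ
    by_cases h : Integrable (g ξ)
    · refine lintegral_mono_ae ?_
      filter_upwards [h.1.ae_eq_mk] with l hl
      simp only [hg', dif_pos h, hl, le_refl]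
    · simp [hg', dif_neg h]
  have hsp : ∀ x t, spacetimeFn g x t = ∑' ξ : ℤ, Stri.e (ξ * x) * Stri.aa g' ξ t := by
    intro x t
    unfold spacetimeFn
    refine tsum_congr fun ξ => ?_
    have e1 : ∀ a b : ℝ, Complex.exp (2 * Real.pi * Complex.I * (a : ℂ) * (b : ℂ)) = Stri.e (a * b) := by
      intro a b; unfold Stri.e; congr 1; push_cast; ring
    have e2 := e1 ξ x
    rw [Complex.ofReal_intCast] at e2
    rw [e2]
    congr 1
    simp_rw [e1]
    by_cases h : Integrable (g ξ)
    · refine integral_congr_ae ?_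
      filter_upwards [h.1.ae_eq_mk] with l hl
      simp only [hg', dif_pos h, hl]
    · have h2 : Stri.aa g' ξ t = 0 := by simp [Stri.aa, hg', dif_neg h]
      rw [h2]
      apply integral_undef
      intro hc
      apply h
      have := Stri.integrable_mul_e hc (-t)
      refine this.congr (Filter.Eventually.of_forall fun l => ?_)
      simp only
      rw [mul_assoc, ← Stri.e_add]
      simp [Stri.e]
  set X := ∑' ξ, ∫⁻ l, ENNReal.ofReal (Stri.wt ξ l * ‖g ξ l‖ ^ 2) with hXd
  have hXN : XNorm038 g = X ^ ((1:ℝ)/2) := rfl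
  have main : (∫⁻ x in Set.Icc (0:ℝ) 1, ∫⁻ t in Set.Icc (0:ℝ) 1,
          ENNReal.ofReal (‖spacetimeFn g x t‖ ^ 4)) ≤ 44 ^ 4 * X ^ 2 := by
    have h := Stri.est_good g' hint hmeas
    have e3 : ∀ x t, ENNReal.ofReal (‖spacetimeFn g x t‖ ^ 4) = 
        ‖∑' ξ : ℤ, Stri.e (ξ * x) * Stri.aa g' ξ t‖ₑ ^ 4 := by
      intro x t
      rw [ENNReal.ofReal_pow (norm_nonneg _), ofReal_norm, hsp]
    simp_rw [e3]
    refine h.trans ?_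
    calc _ ≤ 884736 * (2 * X) ^ 2 := by
          gcongr with ξ
          exact ENNReal.tsum_le_tsum hX
      _ = (884736 * 4) * X ^ 2 := by rw [mul_pow, ← mul_assoc]; norm_num
      _ ≤ _ := by gcongr; norm_num
  calc _ ≤ (44 ^ 4 * X ^ 2) ^ ((1:ℝ)/4) := ENNReal.rpow_le_rpow main (by norm_num)
    _ = _ := by
      rw [hXN, ENNReal.mul_rpow_of_nonneg _ _ (by norm_num), ← ENNReal.rpow_natCast, 
        ← ENNReal.rpow_mul, ← ENNReal.rpow_natCast, ← ENNReal.rpow_mul]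
      norm_num
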